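/- arXiv:2508.21464 — 2 statements merged into one kernel-verified Lean document; each statement's English description precedes it below -/
import Mathlib

section
/- Let ρ : ℝ² → ℝ be continuous, bounded and integrable, let β ∈ ℝ, and define T₁(x,y) = −πβ ∫_ℝ sgn(y−y′) ρ(x,y′) dy′. Then for every smooth compactly supported test function φ : ℝ² → ℝ, ∫_{ℝ²} T₁(x,y) ∂_y φ(x,y) dx dy = 2πβ ∫_{ℝ²} ρ(x,y) φ(x,y) dx dy. That is, the vector field T = (T₁, 0) satisfies curl T = ∂_x T₂ − ∂_y T₁ = 2πβ ρ in the sense of distributions. -/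
open MeasureTheory

lemma aux_measurable_sign : Measurable Real.sign := by
  unfold Real.sign
  exact Measurable.ite measurableSet_Iio measurable_const
    (Measurable.ite measurableSet_Ioi measurable_const measurable_const)

lemma aux_abs_sign (x : ℝ) : |Real.sign x| ≤ 1 := by
  rcases Real.sign_apply_eq x with h | h | h <;> simp [h]

lemma aux_sign_integral (f : ℝ → ℝ) (hf : ContDiff ℝ 1 f) (h : HasCompactSupport f) (a : ℝ) :
    ∫ y, Real.sign (y - a) * deriv f y = -2 * f a := by
  have hi : Integrable (deriv f) :=
    (hf.continuous_deriv le_rfl).integrable_of_hasCompactSupport h.deriv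
  have hi2 : Integrable (fun y => Real.sign (y - a) * deriv f y) := by
    refine hi.bdd_mul (c := 1) ?_ ?_
    · exact (aux_measurable_sign.comp (measurable_id.sub_const a)).aestronglyMeasurable
    · exact Filter.Eventually.of_forall fun y => aux_abs_sign _
  rw [← intervalIntegral.integral_Iic_add_Ioi (b := a) hi2.integrableOn hi2.integrableOn]
  have h1 : ∫ y in Set.Iic a, Real.sign (y - a) * deriv f y = ∫ y in Set.Iic a, - deriv f y := by
    rw [integral_Iic_eq_integral_Iio, integral_Iic_eq_integral_Iio]
    refine setIntegral_congr_fun measurableSet_Iio fun y hy => ?_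
    have : y - a < 0 := sub_neg.2 hy
    simp [Real.sign_of_neg this]
  have h2 : ∫ y in Set.Ioi a, Real.sign (y - a) * deriv f y = ∫ y in Set.Ioi a, deriv f y := by
    refine setIntegral_congr_fun measurableSet_Ioi fun y hy => ?_
    have : 0 < y - a := sub_pos.2 hy
    simp [Real.sign_of_pos this]
  rw [h1, h2, integral_neg, h.integral_Iic_deriv_eq hf, h.integral_Ioi_deriv_eq hf]
  ring

theorem flux_attachment_1D_gauge (ρ : ℝ × ℝ → ℝ) (β : ℝ)
    (hcont : Continuous ρ) (hbdd : ∃ C : ℝ, ∀ p : ℝ × ℝ, |ρ p| ≤ C)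
    (hint : Integrable ρ)
    (φ : ℝ × ℝ → ℝ) (hφ : ContDiff ℝ (⊤ : ℕ∞) φ) (hsupp : HasCompactSupport φ) :
    (∫ p : ℝ × ℝ,
        (-Real.pi * β * ∫ y' : ℝ, Real.sign (p.2 - y') * ρ (p.1, y'))
          * fderiv ℝ φ p (0, 1))
      = 2 * Real.pi * β * ∫ p : ℝ × ℝ, ρ p * φ p := by
  set D : ℝ × ℝ → ℝ := fun p => fderiv ℝ φ p (0, 1) with hD
  have hφ1 : ContDiff ℝ 1 φ := hφ.of_le (by exact_mod_cast le_top)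
  have hDc : Continuous D := (hφ1.continuous_fderiv one_ne_zero).clm_apply continuous_const
  have hDs : HasCompactSupport D := hsupp.fderiv_apply ℝ (0, 1)
  obtain ⟨M, hM⟩ := hDs.exists_bound_of_continuous hDc
  obtain ⟨M', hM'⟩ := hsupp.exists_bound_of_continuous hφ.continuous
  -- slices
  have hslice : ∀ x : ℝ, ContDiff ℝ 1 (fun y => φ (x, y)) := fun x =>
    hφ1.comp (contDiff_const.prodMk contDiff_id)
  have hemb : ∀ x : ℝ, Topology.IsClosedEmbedding (fun y : ℝ => (x, y)) := fun x =>
    Topology.IsClosedEmbedding.of_continuous_injective_isClosedMap (by fun_prop)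
      (fun a b h => by simpa using h) (by
        intro s hs
        have : (fun y : ℝ => (x, y)) '' s = {x} ×ˢ s := by
          ext ⟨a, b⟩; simp; tauto
        rw [this]; exact isClosed_singleton.prod hs)
  have hslices : ∀ x : ℝ, HasCompactSupport (fun y => φ (x, y)) := fun x =>
    hsupp.comp_isClosedEmbedding (hemb x)
  have hderiv : ∀ x y : ℝ, deriv (fun y => φ (x, y)) y = D (x, y) := by
    intro x y
    have h1 : HasFDerivAt φ (fderiv ℝ φ (x, y)) (x, y) :=
      (hφ1.differentiable one_ne_zero _).hasFDerivAt
    have h2 : HasDerivAt (fun y : ℝ => (x, y)) ((0 : ℝ), (1 : ℝ)) y :=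
      (hasDerivAt_const y x).prodMk (hasDerivAt_id y)
    exact (h1.comp_hasDerivAt y h2).deriv
  have hDint : ∀ x, Integrable (fun y => D (x, y)) := fun x =>
    (hDc.comp (by fun_prop : Continuous fun y : ℝ => (x, y))).integrable_of_hasCompactSupport
      (hDs.comp_isClosedEmbedding (hemb x))
  have hae : ∀ᵐ x : ℝ, Integrable (fun y => ρ (x, y)) := hint.prod_right_ae
  have hS : StronglyMeasurable (fun p : ℝ × ℝ => ∫ y', Real.sign (p.2 - y') * ρ (p.1, y')) := by
    apply StronglyMeasurable.integral_prod_right'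
      (f := fun q : (ℝ × ℝ) × ℝ => Real.sign (q.1.2 - q.2) * ρ (q.1.1, q.2))
    apply Measurable.stronglyMeasurable
    apply Measurable.mul
    · exact aux_measurable_sign.comp (by fun_prop)
    · exact hcont.measurable.comp (by fun_prop)
  -- the full integrand is integrable
  have hF : Integrable (fun p : ℝ × ℝ => (∫ y', Real.sign (p.2 - y') * ρ (p.1, y')) * D p) := by
    have hK : IsCompact (Prod.snd '' tsupport D) := hDs.isCompact.image continuous_snd
    have hb : Integrable (fun p : ℝ × ℝ => (∫ y', ‖ρ (p.1, y')‖) *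
        (Prod.snd '' tsupport D).indicator (fun _ => M) p.2) (volume.prod volume) := by
      refine Integrable.mul_prod (f := fun x => ∫ y', ‖ρ (x, y')‖)
        (g := (Prod.snd '' tsupport D).indicator (fun _ => M)) ?_ ?_
      · exact hint.norm.integral_prod_left
      · exact (integrable_indicator_iff hK.measurableSet).2
          (integrableOn_const hK.measure_lt_top.ne)
    refine Integrable.mono' hb (hS.aestronglyMeasurable.mul hDc.aestronglyMeasurable) ?_
    have := (Measure.quasiMeasurePreserving_fst (μ := (volume : Measure ℝ))
      (ν := (volume : Measure ℝ))).ae hae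
    filter_upwards [this] with p hp
    rw [norm_mul]
    refine mul_le_mul ?_ ?_ (norm_nonneg _) (integral_nonneg fun _ => norm_nonneg _)
    · refine norm_integral_le_of_norm_le hp.norm (Filter.Eventually.of_forall fun y => ?_)
      rw [norm_mul]
      exact mul_le_of_le_one_left (norm_nonneg _) (aux_abs_sign _)
    · by_cases h : p ∈ tsupport D
      · rw [Set.indicator_of_mem (Set.mem_image_of_mem _ h)]
        exact hM p
      · rw [image_eq_zero_of_notMem_tsupport h, norm_zero]
        exact Set.indicator_nonneg (fun _ _ => (norm_nonneg _).trans (hM p)) _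
  have hG : Integrable (fun p : ℝ × ℝ => ρ p * φ p) :=
    hint.mul_bdd hφ.continuous.aestronglyMeasurable (Filter.Eventually.of_forall hM')
  have key : ∫ p : ℝ × ℝ, (∫ y', Real.sign (p.2 - y') * ρ (p.1, y')) * D p
      = -2 * ∫ p : ℝ × ℝ, ρ p * φ p := by
    rw [Measure.volume_eq_prod, integral_prod _ hF, integral_prod _ hG, ← integral_const_mul]
    apply integral_congr_ae
    filter_upwards [hae] with x hx
    have e1 : ∀ y : ℝ, (∫ y', Real.sign (y - y') * ρ (x, y')) * D (x, y)
        = ∫ y', Real.sign (y - y') * (D (x, y) * ρ (x, y')) := by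
      intro y
      rw [← integral_mul_const]
      congr 1; ext y'; ring
    simp_rw [e1]
    rw [integral_integral_swap, ← integral_const_mul]
    · congr 1; ext y'
      have := aux_sign_integral _ (hslice x) (hslices x) y'
      simp only [hderiv] at this
      calc _ = ∫ y, (Real.sign (y - y') * D (x, y)) * ρ (x, y') := by
            congr 1; ext y; ring
        _ = _ := by rw [integral_mul_const, this]; ring
    · refine ((hDint x).mul_prod hx).bdd_mul (c := 1) ?_ ?_
      · exact (aux_measurable_sign.comp
          (measurable_fst.sub measurable_snd)).aestronglyMeasurable
      · exact Filter.Eventually.of_forall fun y => aux_abs_sign _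
  simp_rw [mul_assoc (-Real.pi * β)]
  rw [integral_const_mul, key]
  ring
end

section
/- Let ε > 0, β ∈ ℝ, let φ : ℝ → ℂ be differentiable, and let f(y) = ∫_ℝ sgn(y−y′) u_ε(y′)² dy′ with u_ε(y) = (πε)^{-1/4} exp(−y²/(2ε)). Then for every x ∈ ℝ, ∫_ℝ | i φ'(x) + πβ f(y) |φ(x)|² φ(x) |² u_ε(y)² dy = |φ'(x)|² + (π²β²/3) |φ(x)|⁶. -/
open MeasureTheory

/-- The Gaussian ground state `u_ε(y) = (πε)^{-1/4} exp(−y²/(2ε))`. -/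
noncomputable def uGauss (ε y : ℝ) : ℝ :=
  (Real.pi * ε) ^ (-(1/4 : ℝ)) * Real.exp (-(y^2) / (2*ε))

/-- `f(y) = ∫ sgn(y−y′) u_ε(y′)² dy′`. -/
noncomputable def fSgn (ε y : ℝ) : ℝ :=
  ∫ y' : ℝ, Real.sign (y - y') * (uGauss ε y')^2


lemma aux_sq (ε y : ℝ) (hε : 0 < ε) :
    (uGauss ε y)^2 = (√(Real.pi * ε))⁻¹ * Real.exp (-(1/ε) * y^2) := by
  have h : 0 < Real.pi * ε := by positivity
  unfold uGauss
  rw [mul_pow, ← Real.rpow_natCast, ← Real.rpow_mul h.le, ← Real.exp_nat_mul, Real.sqrt_eq_rpow,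
    ← Real.rpow_neg h.le]
  congr 2
  · norm_num
  · push_cast
    field_simp

lemma aux_cont (ε : ℝ) : Continuous fun y => (uGauss ε y)^2 := by
  unfold uGauss
  fun_prop

lemma aux_int (ε : ℝ) (hε : 0 < ε) : Integrable fun y => (uGauss ε y)^2 := by
  simp_rw [fun y => aux_sq ε y hε]
  exact (integrable_exp_neg_mul_sq (by positivity)).const_mul _

lemma aux_one (ε : ℝ) (hε : 0 < ε) : ∫ y, (uGauss ε y)^2 = 1 := by
  simp_rw [fun y => aux_sq ε y hε]
  rw [integral_const_mul, integral_gaussian]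
  have h : 0 < √(Real.pi * ε) := by positivity
  rw [div_div_eq_mul_div, div_one]
  exact inv_mul_cancel₀ h.ne'

lemma aux_split (ε : ℝ) (hε : 0 < ε) (y : ℝ) :
    (∫ t in Set.Iic y, (uGauss ε t)^2) + ∫ t in Set.Ioi y, (uGauss ε t)^2 = 1 := by
  rw [← aux_one ε hε]
  exact intervalIntegral.integral_Iic_add_Ioi (aux_int ε hε).integrableOn
    (aux_int ε hε).integrableOn

lemma aux_f (ε : ℝ) (hε : 0 < ε) (y : ℝ) :
    fSgn ε y = 2 * (∫ t in Set.Iic y, (uGauss ε t)^2) - 1 := by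
  have hi := aux_int ε hε
  have key : fSgn ε y = ∫ t, (2 * (Set.Iic y).indicator (fun t => (uGauss ε t)^2) t
      - (uGauss ε t)^2) := by
    unfold fSgn
    apply integral_congr_ae
    have : ∀ᵐ t : ℝ, t ≠ y := by simp [ae_iff]
    filter_upwards [this] with t ht
    rcases lt_or_gt_of_ne ht with h | h
    · rw [Real.sign_of_pos (by linarith), Set.indicator_of_mem (by exact h.le)]; ring
    · rw [Real.sign_of_neg (by linarith), Set.indicator_of_notMem (by simpa using h)]; ring
  rw [key, integral_sub ((hi.indicator measurableSet_Iic).const_mul 2) hi, integral_const_mul,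
    integral_indicator measurableSet_Iic, aux_one ε hε]

lemma aux_deriv (ε : ℝ) (hε : 0 < ε) (y : ℝ) :
    HasDerivAt (fSgn ε) (2 * (uGauss ε y)^2) y := by
  have hi := aux_int ε hε
  have e : fSgn ε = fun y => 2 * ((∫ t in (0:ℝ)..y, (uGauss ε t)^2)
      + ∫ t in Set.Iic 0, (uGauss ε t)^2) - 1 := by
    funext y
    rw [aux_f ε hε, ← intervalIntegral.integral_Iic_sub_Iic hi.integrableOn hi.integrableOn]
    ring
  rw [e]
  exact (((intervalIntegral.integral_hasDerivAt_right (hi.intervalIntegrable)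
    ((aux_cont ε).stronglyMeasurableAtFilter _ _) (aux_cont ε).continuousAt).add_const
      _).const_mul 2).sub_const 1

lemma aux_top (ε : ℝ) (hε : 0 < ε) : Filter.Tendsto (fSgn ε) Filter.atTop (nhds 1) := by
  have h := (aecover_Iic (μ := volume) (Filter.tendsto_id (α := ℝ)
    (x := Filter.atTop))).integral_tendsto_of_countably_generated (aux_int ε hε)
  rw [aux_one ε hε] at h
  have h2 := (h.const_mul 2).sub_const 1
  norm_num at h2
  rwa [show fSgn ε = _ from funext (aux_f ε hε)]

lemma aux_bot (ε : ℝ) (hε : 0 < ε) : Filter.Tendsto (fSgn ε) Filter.atBot (nhds (-1)) := by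
  have h := (aecover_Ioi (μ := volume) (Filter.tendsto_id (α := ℝ)
    (x := Filter.atBot))).integral_tendsto_of_countably_generated (aux_int ε hε)
  rw [aux_one ε hε] at h
  have h2 := (h.const_mul 2).const_sub 1
  norm_num at h2
  refine h2.congr fun y => ?_
  rw [aux_f ε hε]
  linarith [aux_split ε hε y]

lemma aux_bdd (ε : ℝ) (hε : 0 < ε) (y : ℝ) : |fSgn ε y| ≤ 1 := by
  have h1 : 0 ≤ ∫ t in Set.Iic y, (uGauss ε t)^2 := integral_nonneg fun t => sq_nonneg _
  have h2 : 0 ≤ ∫ t in Set.Ioi y, (uGauss ε t)^2 := integral_nonneg fun t => sq_nonneg _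
  have h3 := aux_split ε hε y
  rw [aux_f ε hε, abs_le]
  constructor <;> linarith

lemma aux_main (ε : ℝ) (hε : 0 < ε) (A B C : ℝ) :
    ∫ y, (A + B * fSgn ε y + C * fSgn ε y ^ 2) * (uGauss ε y)^2 = A + C / 3 := by
  have hc : Continuous (fSgn ε) :=
    continuous_iff_continuousAt.2 fun y => (aux_deriv ε hε y).continuousAt
  have hint : Integrable fun y => (A + B * fSgn ε y + C * fSgn ε y ^ 2) * (uGauss ε y)^2 := by
    refine (aux_int ε hε).bdd_mul (c := |A| + |B| + |C|) (by fun_prop) (ae_of_all _ fun y => ?_)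
    have hb := aux_bdd ε hε y
    rw [Real.norm_eq_abs]
    refine (abs_add_three _ _ _).trans ?_
    rw [abs_mul, abs_mul, abs_pow]
    have : |fSgn ε y| ^ 2 ≤ 1 := pow_le_one₀ (abs_nonneg _) hb
    have := mul_le_mul_of_nonneg_left hb (abs_nonneg B)
    have := mul_le_mul_of_nonneg_left ‹|fSgn ε y| ^ 2 ≤ 1› (abs_nonneg C)
    linarith
  have hP : Continuous fun s : ℝ => A / 2 * s + B / 4 * s ^ 2 + C / 6 * s ^ 3 := by fun_prop
  rw [integral_of_hasDerivAt_of_tendsto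
    (f := fun y => A / 2 * fSgn ε y + B / 4 * fSgn ε y ^ 2 + C / 6 * fSgn ε y ^ 3) ?_ hint
    ((hP.tendsto (-1)).comp (aux_bot ε hε)) ((hP.tendsto 1).comp (aux_top ε hε))]
  · ring
  · intro y
    have h := aux_deriv ε hε y
    refine (((h.const_mul (A/2)).add ((h.pow 2).const_mul (B/4))).add
      ((h.pow 3).const_mul (C/6))).congr_deriv ?_
    norm_num
    ring

/-- Longitudinal magnetic kinetic energy identity: for `ε > 0`, `β ∈ ℝ`, differentiable
`φ : ℝ → ℂ` and every `x`,
`∫ |i φ'(x) + πβ f(y) |φ(x)|² φ(x)|² u_ε(y)² dy = |φ'(x)|² + (π²β²/3)|φ(x)|⁶`. -/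
theorem longitudinal_kinetic_identity (ε β : ℝ) (hε : 0 < ε)
    (φ : ℝ → ℂ) (hφ : Differentiable ℝ φ) (x : ℝ) :
    (∫ y : ℝ,
        ‖Complex.I * deriv φ x
          + ((Real.pi * β * fSgn ε y * ‖φ x‖^2 : ℝ) : ℂ) * φ x‖^2 * (uGauss ε y)^2)
      = ‖deriv φ x‖^2 + (Real.pi^2 * β^2 / 3) * ‖φ x‖^6 := by
  have e : ∀ y, ‖Complex.I * deriv φ x
          + ((Real.pi * β * fSgn ε y * ‖φ x‖^2 : ℝ) : ℂ) * φ x‖^2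
      = ‖deriv φ x‖^2 + (2 * (Real.pi * β * ‖φ x‖^2) *
          ((deriv φ x).re * (φ x).im - (deriv φ x).im * (φ x).re)) * fSgn ε y
        + (Real.pi^2 * β^2 * ‖φ x‖^6) * fSgn ε y ^ 2 := by
    intro y
    have h6 : ‖φ x‖^6 = (‖φ x‖^2)^2 * ‖φ x‖^2 := by ring
    rw [h6]
    generalize hN : (‖φ x‖^2)^2 = N
    have hN' : N = (‖φ x‖^2)^2 := hN.symm
    generalize hM : ‖φ x‖^2 = M at hN' ⊢
    rw [Complex.sq_norm, Complex.normSq_apply] at hM ⊢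
    rw [Complex.sq_norm, Complex.normSq_apply, hN']
    simp only [Complex.add_re, Complex.add_im, Complex.mul_re, Complex.mul_im, Complex.I_re,
      Complex.I_im, Complex.ofReal_re, Complex.ofReal_im]
    linear_combination (Real.pi * β * fSgn ε y * M)^2 * hM
  simp_rw [e]
  rw [aux_main ε hε]
  ring
end
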